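/- Let P be a standard parabolic submonoid of M satisfying Assumption 1, and let b ∈ P and g ∈ M be such that g is P-reduced and b^g is defined. Assume further that Δ_P left-divides bⁱ for some positive integer i. Then g is a P-ribbon. -/

import Mathlib

/-!
Common setting: Garside monoids, standard parabolic submonoids, heads,
ribbons, following Digne–Michel, "Ribbons in Garside monoids".
-/

namespace GarsidePaper

variable {M : Type*}

/-- `a` left-divides `b` : `b = a * c` for some `c`. -/
def LDvd [Monoid M] (a b : M) : Prop := ∃ c, b = a * c

/-- `a` right-divides `b` : `b = c * a` for some `c`. -/
def RDvd [Monoid M] (a b : M) : Prop := ∃ c, b = c * a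

/-- `a` is a factor of `b` : `a` left-divides a right-divisor of `b`. -/
def IsFactor [Monoid M] (a b : M) : Prop := ∃ c, LDvd a c ∧ RDvd c b

/-- A Garside structure on a (left- and right-) cancellative monoid `M`:
left/right gcds and lcms, Noetherianity, and a Garside element `Δ`. -/
structure GarsideStruct (M : Type*) [CancelMonoid M] where
  /-- left-gcd : gcd for the left-divisibility order -/
  lgcd : M → M → M
  lgcd_dvd_left : ∀ a b, LDvd (lgcd a b) a
  lgcd_dvd_right : ∀ a b, LDvd (lgcd a b) b
  lgcd_greatest : ∀ a b d, LDvd d a → LDvd d b → LDvd d (lgcd a b)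
  /-- right-lcm : lcm for the left-divisibility order -/
  rlcm : M → M → M
  ldvd_rlcm_left : ∀ a b, LDvd a (rlcm a b)
  ldvd_rlcm_right : ∀ a b, LDvd b (rlcm a b)
  rlcm_least : ∀ a b m, LDvd a m → LDvd b m → LDvd (rlcm a b) m
  /-- right-gcd : gcd for the right-divisibility order -/
  rgcd : M → M → M
  rgcd_dvd_left : ∀ a b, RDvd (rgcd a b) a
  rgcd_dvd_right : ∀ a b, RDvd (rgcd a b) b
  rgcd_greatest : ∀ a b d, RDvd d a → RDvd d b → RDvd d (rgcd a b)
  /-- left-lcm : lcm for the right-divisibility order -/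
  llcm : M → M → M
  rdvd_llcm_left : ∀ a b, RDvd a (llcm a b)
  rdvd_llcm_right : ∀ a b, RDvd b (llcm a b)
  llcm_least : ∀ a b m, RDvd a m → RDvd b m → RDvd (llcm a b) m
  /-- Noetherian: no infinite sequence where each term is a proper factor
  of the previous one. -/
  noetherian : WellFounded (fun a b : M => IsFactor a b ∧ a ≠ b)
  /-- the Garside element -/
  Δ : M
  /-- the left- and right-divisors of `Δ` coincide -/
  delta_balanced : ∀ a : M, LDvd a Δ ↔ RDvd a Δ
  /-- the divisors of `Δ` generate `M` -/
  delta_generates : Submonoid.closure {a : M | LDvd a Δ} = ⊤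

variable [CancelMonoid M]

/-- An atom: an element with no proper nontrivial divisor (factor). -/
def IsAtom' (a : M) : Prop := a ≠ 1 ∧ ∀ b : M, IsFactor b a → b = 1 ∨ b = a

/-- A standard parabolic submonoid: a submonoid closed under factors in which
every element of `M` has a maximal left-divisor (the left `P`-head) and a
maximal right-divisor (the right `P`-head) lying in `P`. -/
structure IsStdParabolic (P : Submonoid M) : Prop where
  factor_closed : ∀ a b : M, b ∈ P → IsFactor a b → a ∈ P
  exists_left_head : ∀ g : M, ∃ h, h ∈ P ∧ LDvd h g ∧
    ∀ h', h' ∈ P → LDvd h' g → LDvd h' h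
  exists_right_head : ∀ g : M, ∃ h, h ∈ P ∧ RDvd h g ∧
    ∀ h', h' ∈ P → RDvd h' g → RDvd h' h

/-- `h` is the left `P`-head `H_P g` of `g` : the maximal left-divisor of `g`
lying in `P`. -/
def IsLeftHead (P : Set M) (g h : M) : Prop :=
  h ∈ P ∧ LDvd h g ∧ ∀ h', h' ∈ P → LDvd h' g → LDvd h' h

/-- `h` is the right `P`-head of `g` : the maximal right-divisor of `g`
lying in `P`. -/
def IsRightHead (P : Set M) (g h : M) : Prop :=
  h ∈ P ∧ RDvd h g ∧ ∀ h', h' ∈ P → RDvd h' g → RDvd h' h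

/-- `g` is `P`-reduced : `H_P g = 1`, i.e. the only left-divisor of `g`
lying in `P` is `1`. -/
def PReduced (P : Set M) (g : M) : Prop := ∀ h ∈ P, LDvd h g → h = 1

/-- `P ^ g` is defined: `p ^ g` is defined (`g ≼ p * g`) for every `p ∈ P`. -/
def ConjSetDef (P : Set M) (g : M) : Prop := ∀ p ∈ P, LDvd g (p * g)

/-- The set `P ^ g = { p ^ g : p ∈ P }`, where `p ^ g` is the unique `c`
with `p * g = g * c`. -/
def conjSet (P : Set M) (g : M) : Set M := {c : M | ∃ p ∈ P, p * g = g * c}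

/-- A `P`-ribbon: a `P`-reduced element `g` such that `P ^ g` is defined. -/
def IsRibbon (P : Set M) (g : M) : Prop := PReduced P g ∧ ConjSetDef P g

/-- `P` is the smallest standard parabolic submonoid containing `S₁`. -/
def IsSmallestParabolicContaining (S₁ : Set M) (P : Submonoid M) : Prop :=
  IsStdParabolic P ∧ S₁ ⊆ (P : Set M) ∧
    ∀ Q : Submonoid M, IsStdParabolic Q → S₁ ⊆ (Q : Set M) → P ≤ Q

/-- Assumption 1: for any set `S₁` of atoms, the right-lcm of `S₁` is the
Garside element `Δ_{P₁} = H_{P₁}(Δ)` of the smallest standard parabolic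
submonoid `P₁` containing `S₁`. -/
def Assumption1 (G : GarsideStruct M) : Prop :=
  ∀ S₁ : Set M, (∀ s ∈ S₁, IsAtom' s) →
    ∀ P₁ : Submonoid M, IsSmallestParabolicContaining S₁ P₁ →
      ∀ d : M, IsLeftHead (P₁ : Set M) G.Δ d →
        (∀ s ∈ S₁, LDvd s d) ∧ ∀ m : M, (∀ s ∈ S₁, LDvd s m) → LDvd d m

/-- Assumption 2: some (positive) power of `Δ` is central. -/
def Assumption2 (G : GarsideStruct M) : Prop :=
  ∃ n : ℕ, 0 < n ∧ ∀ x : M, G.Δ ^ n * x = x * G.Δ ^ n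

/-- `v = v_{s,P}` : the element defined by `Δ_{P_s} = Δ_P * v`, where `P_s`
is the smallest standard parabolic submonoid containing `P` and `s`. -/
def IsVsp (G : GarsideStruct M) (P : Submonoid M) (s v : M) : Prop :=
  ∃ Ps : Submonoid M, IsSmallestParabolicContaining ((P : Set M) ∪ {s}) Ps ∧
    ∃ dP dPs : M, IsLeftHead (P : Set M) G.Δ dP ∧
      IsLeftHead (Ps : Set M) G.Δ dPs ∧ dPs = dP * v

theorem LDvd.isFactor {a b : M} (h : LDvd a b) : IsFactor a b := ⟨b, h, 1, (one_mul b).symm⟩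

theorem RDvd.isFactor {a b : M} (h : RDvd a b) : IsFactor a b := ⟨a, ⟨1, (mul_one a).symm⟩, h⟩

theorem LDvd.trans {a b c : M} (h : LDvd a b) (h' : LDvd b c) : LDvd a c := by
  obtain ⟨x, rfl⟩ := h
  obtain ⟨y, rfl⟩ := h'
  exact ⟨x * y, mul_assoc _ _ _⟩

theorem RDvd.trans {a b c : M} (h : RDvd a b) (h' : RDvd b c) : RDvd a c := by
  obtain ⟨x, rfl⟩ := h
  obtain ⟨y, rfl⟩ := h'
  exact ⟨y * x, (mul_assoc _ _ _).symm⟩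

theorem isFactor_iff {a b : M} : IsFactor a b ↔ ∃ u w, b = u * a * w := by
  constructor
  · rintro ⟨_, ⟨w, rfl⟩, u, rfl⟩
    exact ⟨u, w, (mul_assoc _ _ _).symm⟩
  · rintro ⟨u, w, rfl⟩
    exact ⟨a * w, ⟨w, rfl⟩, u, mul_assoc _ _ _⟩

theorem LDvd.of_mul_left {x a b : M} (h : LDvd (x * a) (x * b)) : LDvd a b := by
  obtain ⟨w, hw⟩ := h
  exact ⟨w, mul_left_cancel (a := x) (by rw [hw, mul_assoc])⟩

theorem LDvd.mul_left {a b : M} (x : M) (h : LDvd a b) : LDvd (x * a) (x * b) := by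
  obtain ⟨w, rfl⟩ := h
  exact ⟨w, (mul_assoc _ _ _).symm⟩

theorem ldvd_pow_mul {b g : M} (h : LDvd g (b * g)) (n : ℕ) : LDvd g (b ^ n * g) := by
  induction n with
  | zero => exact ⟨1, by simp⟩
  | succ n ih =>
    rw [pow_succ', mul_assoc]
    exact h.trans (ih.mul_left b)

namespace GarsideStruct

theorem factor_antisymm (G : GarsideStruct M) {a b : M} (h : IsFactor a b)
    (h' : IsFactor b a) : a = b := by
  by_contra hne
  exact G.noetherian.asymmetric a b ⟨h, hne⟩ ⟨h', Ne.symm hne⟩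

theorem ldvd_antisymm (G : GarsideStruct M) {a b : M} (h : LDvd a b) (h' : LDvd b a) :
    a = b := G.factor_antisymm h.isFactor h'.isFactor

theorem eq_one_of_mul_left (G : GarsideStruct M) {a b : M} (h : a * b = 1) : a = 1 :=
  G.ldvd_antisymm ⟨b, h.symm⟩ ⟨a, (one_mul a).symm⟩

theorem eq_one_of_mul_right (G : GarsideStruct M) {a b : M} (h : a * b = 1) : b = 1 := by
  rwa [G.eq_one_of_mul_left h, one_mul] at h

theorem exists_atom_ldvd (G : GarsideStruct M) {g : M} (hg : g ≠ 1) :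
    ∃ t, IsAtom' t ∧ LDvd t g := by
  obtain ⟨t, ⟨ht1, htg⟩, hmin⟩ := G.noetherian.has_min {x | x ≠ 1 ∧ LDvd x g}
    ⟨g, hg, 1, (mul_one g).symm⟩
  refine ⟨t, ⟨ht1, fun b hb => ?_⟩, htg⟩
  by_contra! hne
  obtain ⟨u, w, h⟩ := isFactor_iff.1 hb
  by_cases hu : u = 1
  · have hbt : LDvd b t := ⟨w, by rw [h, hu, one_mul]⟩
    exact hmin b ⟨hne.1, hbt.trans htg⟩ ⟨hb, hne.2⟩
  · have hut : LDvd u t := ⟨b * w, by rw [h, mul_assoc]⟩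
    refine hmin u ⟨hu, hut.trans htg⟩ ⟨hut.isFactor, fun hut => hne.1 ?_⟩
    have : b * w = 1 := mul_left_cancel (a := u) (by rw [← mul_assoc, ← h, mul_one, hut])
    exact G.eq_one_of_mul_left this

/-- A submonoid contains every element all of whose atomic factors it contains. -/
theorem mem_of_atoms (G : GarsideStruct M) (Q : Submonoid M) (p : M)
    (h : ∀ s, IsAtom' s → IsFactor s p → s ∈ Q) : p ∈ Q := by
  induction p using G.noetherian.induction with
  | _ p ih =>
    by_cases hp : p = 1
    · rw [hp]; exact Q.one_mem
    obtain ⟨t, ht, w, rfl⟩ := G.exists_atom_ldvd hp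
    refine Q.mul_mem (h t ht (LDvd.isFactor ⟨w, rfl⟩)) (ih w ⟨RDvd.isFactor ⟨t, rfl⟩, fun e => ?_⟩
      fun s hs hsw => ?_)
    · exact ht.1 (mul_right_cancel (b := w) (by rw [one_mul, ← e]))
    · obtain ⟨u, w', h'⟩ := isFactor_iff.1 hsw
      exact h s hs (isFactor_iff.2 ⟨t * u, w', by rw [h']; simp only [mul_assoc]⟩)

theorem isStdParabolic_sInf (G : GarsideStruct M) (F : Set (Submonoid M))
    (hF : ∀ Q ∈ F, IsStdParabolic Q) : IsStdParabolic (sInf F) where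
  factor_closed a b hb hab := Submonoid.mem_sInf.2 fun Q hQ =>
    (hF Q hQ).factor_closed a b (Submonoid.mem_sInf.1 hb Q hQ) hab
  exists_left_head g := by
    obtain ⟨x, ⟨hxg, hx⟩, hmin⟩ := G.noetherian.has_min
      {x | LDvd x g ∧ ∀ h ∈ sInf F, LDvd h g → LDvd h x} ⟨g, ⟨1, (mul_one g).symm⟩, fun _ _ h => h⟩
    refine ⟨x, Submonoid.mem_sInf.2 fun Q hQ => ?_, hxg, hx⟩
    obtain ⟨y, hyQ, hyx, hy⟩ := (hF Q hQ).exists_left_head x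
    by_cases hxy : y = x
    · rwa [← hxy]
    · exact absurd ⟨hyx.isFactor, hxy⟩ (hmin y ⟨hyx.trans hxg, fun h hh hg =>
        hy h (Submonoid.mem_sInf.1 hh Q hQ) (hx h hh hg)⟩)
  exists_right_head g := by
    obtain ⟨x, ⟨hxg, hx⟩, hmin⟩ := G.noetherian.has_min
      {x | RDvd x g ∧ ∀ h ∈ sInf F, RDvd h g → RDvd h x} ⟨g, ⟨1, (one_mul g).symm⟩, fun _ _ h => h⟩
    refine ⟨x, Submonoid.mem_sInf.2 fun Q hQ => ?_, hxg, hx⟩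
    obtain ⟨y, hyQ, hyx, hy⟩ := (hF Q hQ).exists_right_head x
    by_cases hxy : y = x
    · rwa [← hxy]
    · exact absurd ⟨hyx.isFactor, hxy⟩ (hmin y ⟨hyx.trans hxg, fun h hh hg =>
        hy h (Submonoid.mem_sInf.1 hh Q hQ) (hx h hh hg)⟩)

theorem exists_smallest_parabolic (G : GarsideStruct M) (S : Set M) :
    ∃ Q, IsSmallestParabolicContaining S Q :=
  ⟨sInf {Q | IsStdParabolic Q ∧ S ⊆ (Q : Set M)},
    G.isStdParabolic_sInf _ fun _ h => h.1,
    fun _ hx => Submonoid.mem_sInf.2 fun _ hQ => hQ.2 hx,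
    fun _ hQ hS => sInf_le ⟨hQ, hS⟩⟩

/-- The left head of `Δ` in a standard parabolic submonoid is balanced. -/
theorem ldvd_head_iff_rdvd (G : GarsideStruct M) {Q : Submonoid M} (hQ : IsStdParabolic Q)
    {E : M} (hE : IsLeftHead (Q : Set M) G.Δ E) (a : M) : LDvd a E ↔ RDvd a E := by
  obtain ⟨E', hE'Q, hE'd, hE'⟩ := hQ.exists_right_head G.Δ
  have h1 : RDvd E E' := hE' E hE.1 ((G.delta_balanced E).1 hE.2.1)
  have h2 : LDvd E' E := hE.2.2 E' hE'Q ((G.delta_balanced E').2 hE'd)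
  obtain rfl : E = E' := G.factor_antisymm h1.isFactor h2.isFactor
  constructor
  · intro h
    exact hE' a (hQ.factor_closed a E hE.1 h.isFactor)
      ((G.delta_balanced a).1 (h.trans hE.2.1))
  · intro h
    exact hE.2.2 a (hQ.factor_closed a E hE.1 h.isFactor)
      ((G.delta_balanced a).2 (h.trans hE'd))

end GarsideStruct

/-- `E` is an element of `Q` whose conjugation is an automorphism of `Q`. -/
structure IsNormalizing (Q : Submonoid M) (E : M) : Prop where
  mem : E ∈ Q
  right : ∀ x ∈ Q, ∃ y ∈ Q, x * E = E * y
  left : ∀ y ∈ Q, ∃ x ∈ Q, x * E = E * y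

theorem smallest_parabolic_atoms (G : GarsideStruct M) {P : Submonoid M}
    (hP : IsStdParabolic P) :
    IsSmallestParabolicContaining {s | IsAtom' s ∧ s ∈ P} P :=
  ⟨hP, fun _ h => h.2, fun Q _ hS p hp => G.mem_of_atoms Q p fun s hs hsp =>
    hS ⟨hs, hP.factor_closed s p hp hsp⟩⟩

theorem Assumption1.atom_ldvd_head {G : GarsideStruct M} (hA : Assumption1 G) {P : Submonoid M}
    (hP : IsStdParabolic P) {D : M} (hD : IsLeftHead (P : Set M) G.Δ D) {s : M}
    (hs : IsAtom' s) (hsP : s ∈ P) : LDvd s D :=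
  (hA {s | IsAtom' s ∧ s ∈ P} (fun _ h => h.1) P (smallest_parabolic_atoms G hP) D hD).1 s
    ⟨hs, hsP⟩

theorem Assumption1.isNormalizing {G : GarsideStruct M} (hA : Assumption1 G) {Q : Submonoid M}
    (hQ : IsStdParabolic Q) {E : M} (hE : IsLeftHead (Q : Set M) G.Δ E) :
    IsNormalizing Q E := by
  have bal := G.ldvd_head_iff_rdvd hQ hE
  have mem_of {a : M} (h : LDvd a E) : a ∈ Q := hQ.factor_closed a E hE.1 h.isFactor
  let R : Submonoid M :=
    { carrier := {x | ∃ y ∈ Q, x * E = E * y}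
      one_mem' := ⟨1, Q.one_mem, by simp⟩
      mul_mem' := by
        rintro a b ⟨x, hx, hax⟩ ⟨y, hy, hby⟩
        exact ⟨x * y, Q.mul_mem hx hy, by rw [mul_assoc, hby, ← mul_assoc, hax, mul_assoc]⟩ }
  let L : Submonoid M :=
    { carrier := {y | ∃ x ∈ Q, x * E = E * y}
      one_mem' := ⟨1, Q.one_mem, by simp⟩
      mul_mem' := by
        rintro a b ⟨x, hx, hax⟩ ⟨y, hy, hby⟩
        exact ⟨x * y, Q.mul_mem hx hy, by rw [mul_assoc, hby, ← mul_assoc, hax, mul_assoc]⟩ }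
  refine ⟨hE.1, fun x hx => G.mem_of_atoms R x fun s hs hsx => ?_,
    fun x hx => G.mem_of_atoms L x fun s hs hsx => ?_⟩
  · obtain ⟨e, he⟩ := hA.atom_ldvd_head hQ hE hs (hQ.factor_closed s x hx hsx)
    obtain ⟨s', hs'⟩ := (bal e).2 ⟨s, he⟩
    refine ⟨s', mem_of ((bal s').2 ⟨e, hs'⟩), ?_⟩
    conv_lhs => rw [hs', ← mul_assoc, ← he]
  · obtain ⟨e, he⟩ := (bal s).1 (hA.atom_ldvd_head hQ hE hs (hQ.factor_closed s x hx hsx))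
    obtain ⟨s', hs'⟩ := (bal e).1 ⟨s, he⟩
    refine ⟨s', mem_of ⟨e, hs'⟩, ?_⟩
    conv_rhs => rw [hs', mul_assoc, ← he]

namespace IsNormalizing

variable {Q : Submonoid M} {E : M}

theorem ldvd_iff (hE : IsNormalizing Q E) (hQ : IsStdParabolic Q) {x x' y y' : M}
    (hy : y ∈ Q) (hy' : y' ∈ Q) (hx : x * E = E * x') (hyy : y * E = E * y') :
    LDvd x y ↔ LDvd x' y' := by
  constructor
  · rintro ⟨w, rfl⟩
    obtain ⟨w', -, hw⟩ := hE.right w (hQ.factor_closed w _ hy (RDvd.isFactor ⟨x, rfl⟩))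
    refine ⟨w', mul_left_cancel (a := E) ?_⟩
    rw [← hyy, mul_assoc, hw, ← mul_assoc, hx, mul_assoc]
  · rintro ⟨w', rfl⟩
    obtain ⟨w, -, hw⟩ := hE.left w' (hQ.factor_closed w' _ hy' (RDvd.isFactor ⟨x', rfl⟩))
    refine ⟨w, mul_right_cancel (b := E) ?_⟩
    rw [hyy, mul_assoc, hw, ← mul_assoc, ← hx, mul_assoc]

theorem rdvd_iff (hE : IsNormalizing Q E) (hQ : IsStdParabolic Q) {x x' y y' : M}
    (hy : y ∈ Q) (hy' : y' ∈ Q) (hx : x * E = E * x') (hyy : y * E = E * y') :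
    RDvd x y ↔ RDvd x' y' := by
  constructor
  · rintro ⟨w, rfl⟩
    obtain ⟨w', -, hw⟩ := hE.right w (hQ.factor_closed w _ hy (LDvd.isFactor ⟨x, rfl⟩))
    refine ⟨w', mul_left_cancel (a := E) ?_⟩
    rw [← hyy, mul_assoc, hx, ← mul_assoc, hw, mul_assoc]
  · rintro ⟨w', rfl⟩
    obtain ⟨w, -, hw⟩ := hE.left w' (hQ.factor_closed w' _ hy' (LDvd.isFactor ⟨x', rfl⟩))
    refine ⟨w, mul_right_cancel (b := E) ?_⟩
    rw [hyy, mul_assoc, hx, ← mul_assoc, ← hw, mul_assoc]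

end IsNormalizing

/-- `conjSet` as a submonoid. -/
def conjSubmonoid (P : Submonoid M) (g : M) : Submonoid M where
  carrier := conjSet (P : Set M) g
  one_mem' := ⟨1, P.one_mem, by simp⟩
  mul_mem' := by
    rintro a b ⟨x, hx, hax⟩ ⟨y, hy, hby⟩
    exact ⟨x * y, P.mul_mem hx hy, by rw [mul_assoc, hby, ← mul_assoc, hax, mul_assoc]⟩

theorem IsNormalizing.isStdParabolic_conj {P Q : Submonoid M} {E : M} (hE : IsNormalizing Q E)
    (hQ : IsStdParabolic Q) (hP : IsStdParabolic P) (hPQ : P ≤ Q) :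
    IsStdParabolic (conjSubmonoid P E) := by
  have sub : ∀ y ∈ conjSubmonoid P E, y ∈ Q := by
    rintro y ⟨p, hp, hpy⟩
    obtain ⟨y', hy', h⟩ := hE.right p (hPQ hp)
    rwa [mul_left_cancel (hpy.symm.trans h)]
  refine ⟨?_, fun g => ?_, fun g => ?_⟩
  · intro a y hy hay
    have hyQ := sub y hy
    obtain ⟨p, hp, hpy⟩ := hy
    obtain ⟨a', ha', h⟩ := hE.left a (hQ.factor_closed a y hyQ hay)
    refine ⟨a', ?_, h⟩
    obtain ⟨c, hac, hcy⟩ := hay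
    have hcQ := hQ.factor_closed c y hyQ hcy.isFactor
    obtain ⟨c', hc', hcc⟩ := hE.left c hcQ
    exact hP.factor_closed a' p hp ⟨c', (hE.ldvd_iff hQ hc' hcQ h hcc).2 hac,
      (hE.rdvd_iff hQ (hPQ hp) hyQ hcc hpy).2 hcy⟩
  · obtain ⟨k, hkQ, hkg, hk⟩ := hQ.exists_left_head g
    obtain ⟨k', hk', hkk⟩ := hE.left k hkQ
    obtain ⟨h', hhP, hhk, hh⟩ := hP.exists_left_head k'
    obtain ⟨h, hQh, hhh⟩ := hE.right h' (hPQ hhP)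
    refine ⟨h, ⟨h', hhP, hhh⟩, ((hE.ldvd_iff hQ hk' hkQ hhh hkk).1 hhk).trans hkg, ?_⟩
    intro x hx hxg
    have hxk := hk x (sub x hx) hxg
    obtain ⟨x', hx', hxx⟩ := hx
    exact (hE.ldvd_iff hQ (hPQ hhP) hQh hxx hhh).1
      (hh x' hx' ((hE.ldvd_iff hQ hk' hkQ hxx hkk).2 hxk))
  · obtain ⟨k, hkQ, hkg, hk⟩ := hQ.exists_right_head g
    obtain ⟨k', hk', hkk⟩ := hE.left k hkQ
    obtain ⟨h', hhP, hhk, hh⟩ := hP.exists_right_head k'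
    obtain ⟨h, hQh, hhh⟩ := hE.right h' (hPQ hhP)
    refine ⟨h, ⟨h', hhP, hhh⟩, ((hE.rdvd_iff hQ hk' hkQ hhh hkk).1 hhk).trans hkg, ?_⟩
    intro x hx hxg
    have hxk := hk x (sub x hx) hxg
    obtain ⟨x', hx', hxx⟩ := hx
    exact (hE.rdvd_iff hQ (hPQ hhP) hQh hxx hhh).1
      (hh x' hx' ((hE.rdvd_iff hQ hk' hkQ hxx hkk).2 hxk))

theorem IsNormalizing.conjSubmonoid_mul {P : Submonoid M} {D : M} (hD : IsNormalizing P D)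
    (v : M) : conjSubmonoid P (D * v) = conjSubmonoid P v := by
  ext y
  constructor
  · rintro ⟨p, hp, h⟩
    obtain ⟨p', hp', hpp⟩ := hD.right p hp
    refine ⟨p', hp', mul_left_cancel (a := D) ?_⟩
    rw [← mul_assoc, ← hpp, mul_assoc, h, mul_assoc]
  · rintro ⟨p, hp, h⟩
    obtain ⟨p', hp', hpp⟩ := hD.left p hp
    exact ⟨p', hp', by rw [← mul_assoc, hpp, mul_assoc, h, mul_assoc]⟩

section Complement

variable {G : GarsideStruct M} {P Q : Submonoid M} {D v : M}

theorem exists_conj_complement (hQ : IsNormalizing Q (D * v)) (hP : IsNormalizing P D)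
    (hPQ : P ≤ Q) {p : M} (hp : p ∈ P) : ∃ y, p * v = v * y := by
  obtain ⟨p', hp', hpp⟩ := hP.left p hp
  obtain ⟨y, -, h⟩ := hQ.right p' (hPQ hp')
  refine ⟨y, mul_left_cancel (a := D) ?_⟩
  rw [← mul_assoc, ← hpp, mul_assoc, h, mul_assoc]

theorem isLeftHead_conj_complement (hA : Assumption1 G) (hP : IsStdParabolic P)
    (hQ : IsStdParabolic Q) (hPQ : P ≤ Q) (hD : IsLeftHead (P : Set M) G.Δ D)
    (hE : IsLeftHead (Q : Set M) G.Δ (D * v)) {D₁ : M} (h₁ : D * v = v * D₁) :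
    IsLeftHead (conjSubmonoid P v : Set M) G.Δ D₁ := by
  have nQ := hA.isNormalizing hQ hE
  have nP := hA.isNormalizing hP hD
  have bal := G.ldvd_head_iff_rdvd hQ hE
  have hD₁E : LDvd D₁ (D * v) := (bal D₁).2 ⟨v, h₁⟩
  refine ⟨⟨D, hD.1, h₁⟩, hD₁E.trans hE.2.1, fun h hh hhΔ => ?_⟩
  have hD₁Q : D₁ ∈ Q := hQ.factor_closed D₁ _ hE.1 hD₁E.isFactor
  have hDD : D * (D * v) = (D * v) * D₁ := by rw [mul_assoc, ← h₁]
  rw [SetLike.mem_coe, ← nP.conjSubmonoid_mul] at hh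
  obtain ⟨p, hp, hph⟩ := hh
  have hhQ : h ∈ Q := by
    obtain ⟨y, hy, e⟩ := nQ.right p (hPQ hp)
    rwa [mul_left_cancel (hph.symm.trans e)]
  have hpE := (nQ.ldvd_iff hQ hE.1 hE.1 hph rfl).2 (hE.2.2 h hhQ hhΔ)
  exact (nQ.ldvd_iff hQ (hPQ hD.1) hD₁Q hph hDD).1 (hD.2.2 p hp (hpE.trans hE.2.1))

/-- For `q ∈ P`, the right-lcm of `q` and the ribbon `v` is `q * v`. -/
theorem ldvd_of_ldvd_mul_complement (hA : Assumption1 G) (hP : IsStdParabolic P)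
    (hQ : IsStdParabolic Q) (hPQ : P ≤ Q) (hD : IsLeftHead (P : Set M) G.Δ D)
    (hE : IsLeftHead (Q : Set M) G.Δ (D * v)) {q g : M} (hq : q ∈ P) (h : LDvd v (q * g)) :
    LDvd v g := by
  have nQ := hA.isNormalizing hQ hE
  have nP := hA.isNormalizing hP hD
  have bal := G.ldvd_head_iff_rdvd hQ hE
  have par₁ := nQ.isStdParabolic_conj hQ hP hPQ
  obtain ⟨q₁, hq₁⟩ := exists_conj_complement nQ nP hPQ hq
  obtain ⟨D₁, hD₁⟩ := exists_conj_complement nQ nP hPQ hD.1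
  obtain ⟨y, hy⟩ := G.ldvd_rlcm_left q v
  obtain ⟨r, hr⟩ := G.ldvd_rlcm_right q v
  obtain ⟨z, hz⟩ : LDvd y v := by
    apply LDvd.of_mul_left (x := q)
    rw [← hy]
    exact G.rlcm_least _ _ _ ⟨v, rfl⟩ ⟨q₁, hq₁⟩
  have hrz : q₁ = r * z := mul_left_cancel (a := v) (by
    rw [← hq₁, ← mul_assoc, ← hr, hy, mul_assoc, ← hz])
  have hz₁ : z ∈ conjSubmonoid P (D * v) := by
    refine par₁.factor_closed z q₁ ?_ (RDvd.isFactor ⟨r, hrz⟩)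
    rw [nP.conjSubmonoid_mul]
    exact ⟨q, hq, hq₁⟩
  obtain ⟨z', hz'P, hz'⟩ := hz₁
  have hcomm : z' * D * (D * v) = D * v * (z * D₁) := by
    rw [mul_assoc, hD₁, ← mul_assoc D, hD₁, ← mul_assoc, ← hD₁, hz', mul_assoc]
  have hR : RDvd (z' * D) (D * v) := by
    refine (nQ.rdvd_iff hQ hE.1 hE.1 hcomm rfl).2 ⟨y, ?_⟩
    rw [← mul_assoc, ← hz, hD₁]
  have hL : LDvd (z' * D) D :=
    hD.2.2 _ (P.mul_mem hz'P hD.1) (((bal _).2 hR).trans hE.2.1)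
  have hz'1 : z' = 1 := mul_right_cancel (b := D) (by
    rw [one_mul]
    exact G.factor_antisymm hL.isFactor (RDvd.isFactor ⟨z', rfl⟩))
  have hz1 : z = 1 := mul_left_cancel (a := D * v) (by rw [← hz', hz'1, one_mul, mul_one])
  rw [hz1, mul_one] at hz
  apply LDvd.of_mul_left (x := q)
  rw [hz, ← hy]
  exact G.rlcm_least _ _ _ ⟨g, rfl⟩ h

end Complement

theorem exists_parabolic_head_ldvd {G : GarsideStruct M} (hA : Assumption1 G) {P : Submonoid M}
    (hP : IsStdParabolic P) {D : M} (hD : IsLeftHead (P : Set M) G.Δ D) {t : M}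
    (ht : IsAtom' t) :
    ∃ Q : Submonoid M, IsStdParabolic Q ∧ P ≤ Q ∧ t ∈ Q ∧ ∃ v,
      IsLeftHead (Q : Set M) G.Δ (D * v) ∧ ∀ m, LDvd D m → LDvd t m → LDvd (D * v) m := by
  obtain ⟨Q, hQ⟩ := G.exists_smallest_parabolic (insert t {s | IsAtom' s ∧ s ∈ P})
  have hPQ : P ≤ Q :=
    (smallest_parabolic_atoms G hP).2.2 Q hQ.1 ((Set.subset_insert _ _).trans hQ.2.1)
  obtain ⟨E, hE⟩ := hQ.1.exists_left_head G.Δ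
  obtain ⟨v, rfl⟩ := hE.2.2 D (hPQ hD.1) hD.2.1
  refine ⟨Q, hQ.1, hPQ, hQ.2.1 (Set.mem_insert _ _), v, hE, fun m hDm htm => ?_⟩
  refine (hA _ ?_ Q hQ _ hE).2 m ?_
  · rintro s (rfl | hs)
    exacts [ht, hs.1]
  · rintro s (rfl | hs)
    exacts [htm, (hA.atom_ldvd_head hP hD hs.1 hs.2).trans hDm]

theorem conjSetDef_of_head_ldvd {G : GarsideStruct M} (hA : Assumption1 G) (g : M) :
    ∀ (P : Submonoid M), IsStdParabolic P → ∀ b ∈ P, PReduced (P : Set M) g →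
      LDvd g (b * g) → ∀ D, IsLeftHead (P : Set M) G.Δ D → LDvd D b →
      ConjSetDef (P : Set M) g := by
  induction g using G.noetherian.induction with
  | _ g ih =>
    intro P hP b hb hred hconj D hD hDb p hp
    by_cases hg : g = 1
    · exact ⟨p, by simp [hg]⟩
    obtain ⟨t, ht, htg⟩ := G.exists_atom_ldvd hg
    have htP : t ∉ P := fun h => ht.1 (hred t h htg)
    obtain ⟨Q, hQ, hPQ, htQ, v, hE, hleast⟩ := exists_parabolic_head_ldvd hA hP hD ht
    have nQ := hA.isNormalizing hQ hE
    have nP := hA.isNormalizing hP hD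
    obtain ⟨q, rfl⟩ := hDb
    have hq : q ∈ P := hP.factor_closed q _ hb (RDvd.isFactor ⟨D, rfl⟩)
    have hvg : LDvd v g := by
      refine ldvd_of_ldvd_mul_complement hA hP hQ hPQ hD hE hq (LDvd.of_mul_left (x := D) ?_)
      rw [← mul_assoc]
      exact hleast _ ⟨q * g, mul_assoc _ _ _⟩ (htg.trans hconj)
    obtain ⟨g₁, rfl⟩ := hvg
    have hv1 : v ≠ 1 := by
      rintro rfl
      rw [mul_one] at hE
      exact htP (hP.factor_closed t D hD.1 (hA.atom_ldvd_head hQ hE ht htQ).isFactor)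
    obtain ⟨D₁, hD₁⟩ := exists_conj_complement nQ nP hPQ hD.1
    obtain ⟨q₁, hq₁⟩ := exists_conj_complement nQ nP hPQ hq
    obtain ⟨y, hy⟩ := exists_conj_complement nQ nP hPQ hp
    have hb₁ : D * q * v = v * (D₁ * q₁) := by
      rw [mul_assoc, hq₁, ← mul_assoc, hD₁, mul_assoc]
    have par₁ : IsStdParabolic (conjSubmonoid P v) := by
      rw [← nP.conjSubmonoid_mul]
      exact nQ.isStdParabolic_conj hQ hP hPQ
    have hred₁ : PReduced (conjSubmonoid P v : Set M) g₁ := by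
      rintro h ⟨p', hp', hph⟩ hhg
      have : p' = 1 := by
        refine hred p' hp' (LDvd.trans ⟨v, rfl⟩ ?_)
        rw [hph]
        exact hhg.mul_left v
      exact mul_left_cancel (a := v) (by rw [← hph, this, one_mul, mul_one])
    have hconj₁ : LDvd g₁ (D₁ * q₁ * g₁) := by
      apply LDvd.of_mul_left (x := v)
      rwa [← mul_assoc v (D₁ * q₁), ← hb₁, mul_assoc (D * q)]
    have hlt : IsFactor g₁ (v * g₁) ∧ g₁ ≠ v * g₁ :=
      ⟨RDvd.isFactor ⟨v, rfl⟩,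
        fun e => hv1 (mul_right_cancel (b := g₁) (by rw [← e, one_mul]))⟩
    have key := (ih g₁ hlt (conjSubmonoid P v) par₁ (D₁ * q₁) ⟨D * q, hb, hb₁⟩ hred₁ hconj₁ D₁
      (isLeftHead_conj_complement hA hP hQ hPQ hD hE hD₁) ⟨q₁, rfl⟩ y ⟨p, hp, hy⟩).mul_left v
    rwa [← mul_assoc v y, ← hy, mul_assoc p] at key

/-- if `b ∈ P`, `g` is `P`-reduced, `b ^ g` is defined and
`Δ_P` left-divides `b ^ i` for some `i > 0`, then `g` is a `P`-ribbon. -/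
theorem statement14 (G : GarsideStruct M) (hA : Assumption1 G)
    (P : Submonoid M) (hP : IsStdParabolic P)
    (b : M) (hb : b ∈ P) (g : M) (hred : PReduced (P : Set M) g)
    (hconj : LDvd g (b * g))
    (dP : M) (hdP : IsLeftHead (P : Set M) G.Δ dP)
    (i : ℕ) (hi : 0 < i) (hdvd : LDvd dP (b ^ i)) :
    IsRibbon (P : Set M) g := by
  exact ⟨hred, conjSetDef_of_head_ldvd hA g P hP (b ^ i) (P.pow_mem hb i) hred
    (ldvd_pow_mul hconj i) dP hdP hdvd⟩

end GarsidePaper
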